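/- Upper bounds on the closest reachable point on the +x-axis (clean cases): Let σ be a turn sequence with l L's and r R's. (i) If l − r = 2 and σ₁ = R, then there exists a chain realizing σ whose endpoint is (a, 0) with 1 ≤ a ≤ 2. (ii) If l − r = 3 and σ₁ = R, then there exists such a chain with 1 ≤ a ≤ 2. (iii) If l − r = 5 and σ₁ = L, then there exists such a chain with 1 ≤ a ≤ 2. (iv) If l − r ≥ 6 and l − r ≡ 2 (mod 4), then: if σ₁ = L there exists such a chain with 1 ≤ a ≤ ⌊(l − r + 2)/4⌋, and if σ₁ = R there exists such a chain with 1 ≤ a ≤ ⌊(l − r + 2)/4⌋ + 1. -/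

import Mathlib

/-- A turn: left (`L`) or right (`R`). -/
inductive Turn : Type
  | L : Turn
  | R : Turn
  deriving DecidableEq

/-- Rotation of a direction vector by 90° counterclockwise. -/
def rotCCW (d : ℤ × ℤ) : ℤ × ℤ := (-d.2, d.1)

/-- Rotation of a direction vector by 90° clockwise. -/
def rotCW (d : ℤ × ℤ) : ℤ × ℤ := (d.2, -d.1)

/-- Unit direction of the axis-parallel segment from `u` to `v`. -/
def unitDir (u v : ℤ × ℤ) : ℤ × ℤ := ((v.1 - u.1).sign, (v.2 - u.2).sign)

/-- The set of integer points on the axis-parallel closed segment from `u` to `v`. -/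
def segSet (u v : ℤ × ℤ) : Set (ℤ × ℤ) :=
  {q | min u.1 v.1 ≤ q.1 ∧ q.1 ≤ max u.1 v.1 ∧ min u.2 v.2 ≤ q.2 ∧ q.2 ≤ max u.2 v.2}

/-- A simple rectilinear chain realizing the turn sequence `σ = σ₁⋯σₙ` (as a list,
`σ.get ⟨i, _⟩` is the `(i+1)`-st turn `σ_{i+1}`).  It consists of the points
`pts 0, …, pts (n+1)` with `pts 0 = (0,0)`; consecutive points span nondegenerate
axis-parallel segments, the first segment heads east, the chain turns left (CCW) or
right (CW) at each bend as prescribed by `σ`, and the chain is simple. -/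
structure Chain (σ : List Turn) where
  pts : ℕ → ℤ × ℤ
  start_eq : pts 0 = (0, 0)
  first_seg : ∃ t : ℤ, 0 < t ∧ pts 1 = (t, 0)
  axis_parallel : ∀ i ≤ σ.length,
    ((pts (i + 1)).1 = (pts i).1 ∧ (pts (i + 1)).2 ≠ (pts i).2) ∨
    ((pts (i + 1)).2 = (pts i).2 ∧ (pts (i + 1)).1 ≠ (pts i).1)
  turns : ∀ i, ∀ h : i < σ.length,
    unitDir (pts (i + 1)) (pts (i + 2)) =
      (if σ.get ⟨i, h⟩ = Turn.L then rotCCW else rotCW) (unitDir (pts i) (pts (i + 1)))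
  simple_adj : ∀ i, i + 1 ≤ σ.length →
    segSet (pts i) (pts (i + 1)) ∩ segSet (pts (i + 1)) (pts (i + 2)) = {pts (i + 1)}
  simple_nonadj : ∀ i j, i + 1 < j → j ≤ σ.length →
    segSet (pts i) (pts (i + 1)) ∩ segSet (pts j) (pts (j + 1)) = ∅

/-- `A(σ)`: the set of points reachable by the turn sequence `σ`. -/
def ReachSet (σ : List Turn) : Set (ℤ × ℤ) :=
  {q | ∃ C : Chain σ, C.pts (σ.length + 1) = q}

/-- The halfplane `V⁺(p)` (requires `p.1 ≠ 0` to be meaningful). -/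
def Vplus (p : ℤ × ℤ) : Set (ℤ × ℤ) :=
  {q | ∃ i j : ℤ, 0 ≤ i ∧ q = (p.1 + p.1.sign * i, j)}

/-- The halfplane `H⁺(p)` (requires `p.2 ≠ 0` to be meaningful). -/
def Hplus (p : ℤ × ℤ) : Set (ℤ × ℤ) :=
  {q | ∃ i j : ℤ, 0 ≤ j ∧ q = (i, p.2 + p.2.sign * j)}

/-- The quadrant `Q⁺(p)`. -/
def Qplus (p : ℤ × ℤ) : Set (ℤ × ℤ) := Vplus p ∩ Hplus p

/-- A staircase: consecutive turns always differ. -/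
def IsStaircase (σ : List Turn) : Prop := σ.Chain' (· ≠ ·)

/-- The prefix number `δᵢ`: number of `L`s minus number of `R`s among the first `i` turns. -/
def delta (σ : List Turn) (i : ℕ) : ℤ :=
  ((σ.take i).count Turn.L : ℤ) - ((σ.take i).count Turn.R : ℤ)

/-- The excess number `l - r` of a turn sequence. -/
def excess (σ : List Turn) : ℤ := (σ.count Turn.L : ℤ) - (σ.count Turn.R : ℤ)

/-- `σ` has a hook (two equal consecutive turns, at 1-based positions `k+1, k+2`)
whose prefix number is `≡ d (mod 4)`: `d = 0, 1, 2, 3` for right, up, left, down hooks. -/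
def HasHook (σ : List Turn) (d : ℤ) : Prop :=
  ∃ k, ∃ h : k + 1 < σ.length,
    σ.get ⟨k, by omega⟩ = σ.get ⟨k + 1, h⟩ ∧ delta σ (k + 1) % 4 = d

/-- `σ` has some hook, i.e. two equal consecutive turns. -/
def HasAnyHook (σ : List Turn) : Prop :=
  ∃ k, ∃ h : k + 1 < σ.length, σ.get ⟨k, by omega⟩ = σ.get ⟨k + 1, h⟩

/-- A set `S ⊆ ℤ²` is connected: any two points of `S` are joined by a path inside `S`
whose consecutive points are at `L¹`-distance `1`. -/
def GridConnected (S : Set (ℤ × ℤ)) : Prop :=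
  ∀ p ∈ S, ∀ q ∈ S, ∃ (n : ℕ) (f : ℕ → ℤ × ℤ),
    f 0 = p ∧ f n = q ∧ (∀ i ≤ n, f i ∈ S) ∧
    ∀ i < n, |(f (i + 1)).1 - (f i).1| + |(f (i + 1)).2 - (f i).2| = 1

/-- `q` lies on the boundary of the smallest axis-parallel bounding box of the chain `C`
(for `q` a point of the chain: it attains an extreme coordinate). -/
def OnBBoxBoundary (σ : List Turn) (C : Chain σ) (q : ℤ × ℤ) : Prop :=
  (∀ i ≤ σ.length + 1, q.1 ≤ (C.pts i).1) ∨ (∀ i ≤ σ.length + 1, (C.pts i).1 ≤ q.1) ∨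
  (∀ i ≤ σ.length + 1, q.2 ≤ (C.pts i).2) ∨ (∀ i ≤ σ.length + 1, (C.pts i).2 ≤ q.2)

/-- The last segment of the chain `C` is entirely contained in one side of the smallest
axis-parallel bounding box of `C`. -/
def LastSegOnSide (σ : List Turn) (C : Chain σ) : Prop :=
  ((C.pts σ.length).1 = (C.pts (σ.length + 1)).1 ∧
     ∀ i ≤ σ.length + 1, (C.pts σ.length).1 ≤ (C.pts i).1) ∨
  ((C.pts σ.length).1 = (C.pts (σ.length + 1)).1 ∧
     ∀ i ≤ σ.length + 1, (C.pts i).1 ≤ (C.pts σ.length).1) ∨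
  ((C.pts σ.length).2 = (C.pts (σ.length + 1)).2 ∧
     ∀ i ≤ σ.length + 1, (C.pts σ.length).2 ≤ (C.pts i).2) ∨
  ((C.pts σ.length).2 = (C.pts (σ.length + 1)).2 ∧
     ∀ i ≤ σ.length + 1, (C.pts i).2 ≤ (C.pts σ.length).2)

/-- The turn `σₘ` (1-based indexing). -/
def turnAt (σ : List Turn) (m : ℕ) : Turn := σ.getD (m - 1) Turn.L

/-- The suffix `σ_k ⋯ σ_n` contains no hook and all its prefix numbers `δᵢ`,
`k - 1 ≤ i ≤ n`, are `≡ 1` or `2 (mod 4)` (the combinatorial description of a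
NW-staircase containing the endpoint). -/
def GoodSuffix (σ : List Turn) (k : ℕ) : Prop :=
  1 ≤ k ∧ k ≤ σ.length ∧
  (∀ m : ℕ, k ≤ m → m < σ.length → turnAt σ m ≠ turnAt σ (m + 1)) ∧
  (∀ i : ℕ, k - 1 ≤ i → i ≤ σ.length → delta σ i % 4 = 1 ∨ delta σ i % 4 = 2)

open Classical in
/-- `₋ₓm₊ᵧᵖ(σ)`: taking the longest good suffix (i.e. the least `k` with
`GoodSuffix σ k`), the number of indices `i` with `k - 1 ≤ i ≤ n` and
`δᵢ ≡ 1 (mod 4)`; `0` if no good suffix exists. -/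
noncomputable def mNWp (σ : List Turn) : ℕ :=
  if ∃ k, GoodSuffix σ k then
    Nat.card {i : ℕ // sInf {k | GoodSuffix σ k} - 1 ≤ i ∧ i ≤ σ.length ∧
      delta σ i % 4 = 1}
  else 0

/-- The number of vertical segments of the chain `C` meeting the closed horizontal
segment from the origin to `(a, 0)`. -/
def verticalCrossCount (σ : List Turn) (C : Chain σ) (a : ℤ) : ℕ :=
  ((Finset.range (σ.length + 1)).filter fun i =>
    (C.pts i).1 = (C.pts (i + 1)).1 ∧
    0 ≤ (C.pts i).1 ∧ (C.pts i).1 ≤ a ∧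
    min (C.pts i).2 (C.pts (i + 1)).2 ≤ 0 ∧ 0 ≤ max (C.pts i).2 (C.pts (i + 1)).2).card

/-- The unit direction of the `(i+1)`-st segment of the chain `C`. -/
def dirOf (σ : List Turn) (C : Chain σ) (i : ℕ) : ℤ × ℤ := unitDir (C.pts i) (C.pts (i + 1))

/-- `z₁mz₂ᵒ(C)`: the number of `z₂`-segments in the maximal `(z₁,z₂)`-staircase subchain
of `C` containing the origin (the longest prefix of segments directed `z₁` or `z₂`);
`0` if no such subchain exists. -/
noncomputable def stairCountO (σ : List Turn) (C : Chain σ) (z₁ z₂ : ℤ × ℤ) : ℕ :=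
  Nat.card {i : ℕ // i ≤ σ.length ∧ dirOf σ C i = z₂ ∧
    ∀ j ≤ i, dirOf σ C j = z₁ ∨ dirOf σ C j = z₂}

/-- `z₁mz₂ᵖ(C)`: the number of `z₂`-segments in the maximal `(z₁,z₂)`-staircase subchain
of `C` containing the endpoint (the longest suffix of segments directed `z₁` or `z₂`);
`0` if no such subchain exists. -/
noncomputable def stairCountP (σ : List Turn) (C : Chain σ) (z₁ z₂ : ℤ × ℤ) : ℕ :=
  Nat.card {i : ℕ // i ≤ σ.length ∧ dirOf σ C i = z₂ ∧
    ∀ j, i ≤ j → j ≤ σ.length → dirOf σ C j = z₁ ∨ dirOf σ C j = z₂}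

/-- The heading after the turn `t`. -/
def Turn.rot (t : Turn) (d : ℤ × ℤ) : ℤ × ℤ := (if t = Turn.L then rotCCW else rotCW) d

@[simp] theorem Turn.rot_L (a b : ℤ) : Turn.L.rot (a, b) = (-b, a) := rfl

@[simp] theorem Turn.rot_R (a b : ℤ) : Turn.R.rot (a, b) = (b, -a) := rfl

theorem Turn.rot_rotCCW (t : Turn) (d : ℤ × ℤ) : t.rot (rotCCW d) = rotCCW (t.rot d) := by
  cases t <;> simp [Turn.rot, rotCCW, rotCW]

theorem rotCCW_add (u v : ℤ × ℤ) : rotCCW (u + v) = rotCCW u + rotCCW v := by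
  ext <;> simp [rotCCW]; ring

/-! ### Excess -/

@[simp] theorem excess_nil : excess [] = 0 := rfl

@[simp] theorem excess_append (u v : List Turn) : excess (u ++ v) = excess u + excess v := by
  simp only [excess, List.count_append]; push_cast; ring

@[simp] theorem excess_cons_L (v : List Turn) : excess (Turn.L :: v) = 1 + excess v := by
  simp [excess]; ring

@[simp] theorem excess_cons_R (v : List Turn) : excess (Turn.R :: v) = -1 + excess v := by
  simp [excess]; ring

/-- A word whose excess exceeds `k ≥ 0` has an `L` leading from prefix number `k` to `k + 1`. -/
theorem exists_split_L (k : ℤ) (hk : 0 ≤ k) (w : List Turn) (hw : k + 1 ≤ excess w) :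
    ∃ u v, w = u ++ Turn.L :: v ∧ excess u = k := by
  induction w using List.reverseRecOn with
  | nil => simp at hw; omega
  | append_singleton w x ih =>
    by_cases h : k + 1 ≤ excess w
    · obtain ⟨u, v, rfl, hu⟩ := ih h
      exact ⟨u, v ++ [x], by simp, hu⟩
    · cases x <;> simp at hw
      · exact ⟨w, [], rfl, by omega⟩
      · omega

/-- A word of negative excess has an `R` leading from prefix number `0` to `-1`. -/
theorem exists_split_R (w : List Turn) (hw : excess w ≤ -1) :
    ∃ u v, w = u ++ Turn.R :: v ∧ excess u = 0 := by
  induction w using List.reverseRecOn with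
  | nil => simp at hw
  | append_singleton w x ih =>
    by_cases h : excess w ≤ -1
    · obtain ⟨u, v, rfl, hu⟩ := ih h
      exact ⟨u, v ++ [x], by simp, hu⟩
    · cases x <;> simp at hw
      · omega
      · exact ⟨w, [], rfl, by omega⟩

/-- A word of excess at least `k + 2`, where `k ≥ 0`, has a left hook leading from prefix
number `k` to `k + 2`. -/
theorem exists_left_hook (k : ℤ) (hk : 0 ≤ k) (w : List Turn) (hw : k + 2 ≤ excess w) :
    ∃ u v, w = u ++ Turn.L :: Turn.L :: v ∧ excess u = k := by
  induction hn : w.length using Nat.strong_induction_on generalizing w with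
  | _ n ih =>
    subst hn
    rcases List.eq_nil_or_concat w with rfl | ⟨w', x, rfl⟩
    · simp at hw; omega
    simp only [List.concat_eq_append] at *
    by_cases h : k + 2 ≤ excess w'
    · obtain ⟨u, v, rfl, hu⟩ := ih w'.length (by simp) w' h rfl
      exact ⟨u, v ++ [x], by simp, hu⟩
    rcases List.eq_nil_or_concat w' with rfl | ⟨w'', y, rfl⟩
    · cases x <;> simp at hw <;> omega
    simp only [List.concat_eq_append] at *
    cases x <;> cases y <;> simp at hw h
    · exact ⟨w'', [], by simp, by omega⟩
    · obtain ⟨u, v, rfl, hu⟩ := ih w''.length (by simp) w'' (by omega) rfl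
      exact ⟨u, v ++ [Turn.R, Turn.L], by simp, hu⟩
    all_goals omega

/-! ### Self-avoiding walks -/

/-- `Walk p d w S q e`: a self-avoiding walk by unit steps from `p` to `q` with initial heading `d`
and final heading `e` visits exactly the points of `S` and makes the turns `w`. -/
inductive Walk (p d : ℤ × ℤ) : List Turn → Set (ℤ × ℤ) → ℤ × ℤ → ℤ × ℤ → Prop
  | single : Walk p d [] {p} p d
  | fwd {w S q e} (h : Walk p d w S q e) (hq : q + e ∉ S) : Walk p d w (insert (q + e) S) (q + e) e
  | turn {w S q e} (t : Turn) (h : Walk p d w S q e) (hq : q + t.rot e ∉ S) :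
      Walk p d (w ++ [t]) (insert (q + t.rot e) S) (q + t.rot e) (t.rot e)

theorem Walk.join_fwd {p d q e r f : ℤ × ℤ} {w w' : List Turn} {S S' : Set (ℤ × ℤ)}
    (h : Walk p d w S q e) (h' : Walk (q + e) e w' S' r f) (hS : Disjoint S S') :
    Walk p d (w ++ w') (S ∪ S') r f := by
  induction h' with
  | single =>
    rw [Set.disjoint_singleton_right] at hS
    simpa using h.fwd hS
  | fwd _ hq ih =>
    rw [Set.disjoint_insert_right] at hS
    rw [Set.union_insert]
    exact (ih hS.2).fwd (by simp [hq, hS.1])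
  | turn t _ hq ih =>
    rw [Set.disjoint_insert_right] at hS
    rw [Set.union_insert, ← List.append_assoc]
    exact (ih hS.2).turn t (by simp [hq, hS.1])

theorem Walk.join_turn {p d q e r f : ℤ × ℤ} {w w' : List Turn} {S S' : Set (ℤ × ℤ)} (t : Turn)
    (h : Walk p d w S q e) (h' : Walk (q + t.rot e) (t.rot e) w' S' r f) (hS : Disjoint S S') :
    Walk p d (w ++ t :: w') (S ∪ S') r f := by
  induction h' with
  | single =>
    rw [Set.disjoint_singleton_right] at hS
    simpa using h.turn t hS
  | fwd _ hq ih =>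
    rw [Set.disjoint_insert_right] at hS
    rw [Set.union_insert]
    exact (ih hS.2).fwd (by simp [hq, hS.1])
  | turn s _ hq ih =>
    rw [Set.disjoint_insert_right] at hS
    rw [Set.union_insert, ← List.cons_append, ← List.append_assoc]
    exact (ih hS.2).turn s (by simp [hq, hS.1])

theorem rotCCW_injective : Function.Injective rotCCW := by
  intro u v h
  simp only [rotCCW, Prod.mk.injEq, neg_inj] at h
  exact Prod.ext h.2 h.1

theorem Walk.rotate {p d q e : ℤ × ℤ} {w : List Turn} {S : Set (ℤ × ℤ)} (h : Walk p d w S q e) :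
    Walk (rotCCW p) (rotCCW d) w (rotCCW '' S) (rotCCW q) (rotCCW e) := by
  induction h with
  | single => simpa using Walk.single
  | fwd _ hq ih =>
    rw [Set.image_insert_eq, rotCCW_add]
    exact ih.fwd (by rwa [← rotCCW_add, rotCCW_injective.mem_set_image])
  | turn t _ hq ih =>
    rw [Set.image_insert_eq, rotCCW_add, ← Turn.rot_rotCCW]
    exact ih.turn t (by rwa [Turn.rot_rotCCW, ← rotCCW_add, rotCCW_injective.mem_set_image])

/-- A self-avoiding walk as in `Walk` all of whose points lie in the region `P`. -/
def WalkIn (p d : ℤ × ℤ) (w : List Turn) (P : ℤ → ℤ → Prop) (q e : ℤ × ℤ) : Prop :=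
  ∃ S, Walk p d w S q e ∧ ∀ x y, (x, y) ∈ S → P x y

theorem WalkIn.mono {p d q e : ℤ × ℤ} {w : List Turn} {P P' : ℤ → ℤ → Prop} (h : WalkIn p d w P q e)
    (hP : ∀ x y, P x y → P' x y) : WalkIn p d w P' q e := by
  obtain ⟨S, hS, hSP⟩ := h
  exact ⟨S, hS, fun x y hxy => hP x y (hSP x y hxy)⟩

theorem WalkIn.single (a b : ℤ) (d : ℤ × ℤ) :
    WalkIn (a, b) d [] (fun x y => x = a ∧ y = b) (a, b) d :=
  ⟨_, Walk.single, fun x y h => by simpa using h⟩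

theorem WalkIn.join_fwd {p d q e q' r f : ℤ × ℤ} {w w' : List Turn} {P P' : ℤ → ℤ → Prop}
    (h : WalkIn p d w P q e) (h' : WalkIn q' e w' P' r f) (hq : q' = q + e)
    (hP : ∀ x y, P x y → ¬ P' x y) : WalkIn p d (w ++ w') (fun x y => P x y ∨ P' x y) r f := by
  subst hq
  obtain ⟨S, hS, hSP⟩ := h
  obtain ⟨S', hS', hSP'⟩ := h'
  refine ⟨_, hS.join_fwd hS' ?_, fun x y => Or.imp (hSP x y) (hSP' x y)⟩
  exact Set.disjoint_left.2 fun ⟨x, y⟩ hx hx' => hP x y (hSP x y hx) (hSP' x y hx')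

theorem WalkIn.join_turn {p d q e q' e' r f : ℤ × ℤ} {w w' : List Turn} {P P' : ℤ → ℤ → Prop}
    (t : Turn) (h : WalkIn p d w P q e) (h' : WalkIn q' e' w' P' r f) (he : e' = t.rot e)
    (hq : q' = q + e') (hP : ∀ x y, P x y → ¬ P' x y) :
    WalkIn p d (w ++ t :: w') (fun x y => P x y ∨ P' x y) r f := by
  subst he hq
  obtain ⟨S, hS, hSP⟩ := h
  obtain ⟨S', hS', hSP'⟩ := h'
  refine ⟨_, hS.join_turn t hS' ?_, fun x y => Or.imp (hSP x y) (hSP' x y)⟩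
  exact Set.disjoint_left.2 fun ⟨x, y⟩ hx hx' => hP x y (hSP x y hx) (hSP' x y hx')

theorem WalkIn.rotate {a b c d a' b' c' d' : ℤ} {w : List Turn} {P : ℤ → ℤ → Prop}
    (h : WalkIn (a, b) (c, d) w P (a', b') (c', d')) :
    WalkIn (-b, a) (-d, c) w (fun x y => P y (-x)) (-b', a') (-d', c') := by
  obtain ⟨S, hS, hSP⟩ := h
  refine ⟨_, hS.rotate, ?_⟩
  rintro x y ⟨⟨u, v⟩, hu, huv⟩
  simp only [rotCCW, Prod.mk.injEq] at huv
  obtain ⟨rfl, rfl⟩ := huv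
  simpa using hSP _ _ hu

theorem WalkIn.east (a b c : ℤ) (hc : a ≤ c) :
    WalkIn (a, b) (1, 0) [] (fun x y => a ≤ x ∧ x ≤ c ∧ y = b) (c, b) (1, 0) := by
  induction c, hc using Int.leInduction with
  | base => exact (WalkIn.single a b _).mono (by omega)
  | succ c hc ih =>
    exact (ih.join_fwd (WalkIn.single (c + 1) b (1, 0)) (by simp) (by omega)).mono (by omega)

theorem WalkIn.north (a b c : ℤ) (hc : b ≤ c) :
    WalkIn (a, b) (0, 1) [] (fun x y => b ≤ y ∧ y ≤ c ∧ x = a) (a, c) (0, 1) := by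
  simpa using (WalkIn.east b (-a) c hc).rotate.mono (by omega)

theorem WalkIn.west (a b c : ℤ) (hc : c ≤ a) :
    WalkIn (a, b) (-1, 0) [] (fun x y => c ≤ x ∧ x ≤ a ∧ y = b) (c, b) (-1, 0) := by
  simpa using (WalkIn.north b (-a) (-c) (by omega)).rotate.mono (by omega)

theorem WalkIn.south (a b c : ℤ) (hc : c ≤ b) :
    WalkIn (a, b) (0, -1) [] (fun x y => c ≤ y ∧ y ≤ b ∧ x = a) (a, c) (0, -1) := by
  simpa using (WalkIn.west b (-a) c hc).rotate.mono (by omega)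

/-! ### Tubes -/

/-- From every point `(a, b)`, heading east, a walk with turns `w` runs through the tube of length
`X` and half-width `B` ahead of it and leaves the tube at its far side, displaced to the left
by `Y`. -/
def IsTube (w : List Turn) (X B Y : ℤ) : Prop :=
  0 < X ∧ -B ≤ Y ∧ Y ≤ B ∧ ∀ a b, WalkIn (a + 1, b) (1, 0) w
    (fun x y => a < x ∧ x < a + X ∧ b - B ≤ y ∧ y ≤ b + B ∨ x = a + X ∧ y = b + Y)
    (a + X, b + Y) (1, 0)

section Tube

variable {w : List Turn} {X B Y : ℤ}

theorem IsTube.east (h : IsTube w X B Y) (a b : ℤ) : WalkIn (a + 1, b) (1, 0) w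
    (fun x y => a < x ∧ x < a + X ∧ b - B ≤ y ∧ y ≤ b + B ∨ x = a + X ∧ y = b + Y)
    (a + X, b + Y) (1, 0) :=
  h.2.2.2 a b

theorem IsTube.north (h : IsTube w X B Y) (a b : ℤ) : WalkIn (a, b + 1) (0, 1) w
    (fun x y => b < y ∧ y < b + X ∧ a - B ≤ x ∧ x ≤ a + B ∨ y = b + X ∧ x = a - Y)
    (a - Y, b + X) (0, 1) := by
  have := (h.east b (-a)).rotate.mono
    (P' := fun x y => b < y ∧ y < b + X ∧ a - B ≤ x ∧ x ≤ a + B ∨ y = b + X ∧ x = a - Y) (by omega)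
  simpa [sub_eq_neg_add, add_comm] using this

theorem IsTube.west (h : IsTube w X B Y) (a b : ℤ) : WalkIn (a - 1, b) (-1, 0) w
    (fun x y => a - X < x ∧ x < a ∧ b - B ≤ y ∧ y ≤ b + B ∨ x = a - X ∧ y = b - Y)
    (a - X, b - Y) (-1, 0) := by
  have := (h.north b (-a)).rotate.mono
    (P' := fun x y => a - X < x ∧ x < a ∧ b - B ≤ y ∧ y ≤ b + B ∨ x = a - X ∧ y = b - Y) (by omega)
  simpa [sub_eq_neg_add, add_comm] using this

theorem IsTube.south (h : IsTube w X B Y) (a b : ℤ) : WalkIn (a, b - 1) (0, -1) w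
    (fun x y => b - X < y ∧ y < b ∧ a - B ≤ x ∧ x ≤ a + B ∨ y = b - X ∧ x = a + Y)
    (a + Y, b - X) (0, -1) := by
  have := (h.west b (-a)).rotate.mono
    (P' := fun x y => b - X < y ∧ y < b ∧ a - B ≤ x ∧ x ≤ a + B ∨ y = b - X ∧ x = a + Y) (by omega)
  simpa [sub_eq_neg_add, add_comm] using this

theorem isTube_nil : IsTube [] 1 0 0 :=
  ⟨by omega, by omega, by omega, fun a b => by
    simpa using (WalkIn.single (a + 1) b (1, 0)).mono (by omega)⟩

theorem IsTube.append {w' : List Turn} {X' B' Y' : ℤ} (h : IsTube w X B Y)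
    (h' : IsTube w' X' B' Y') : IsTube (w ++ w') (X + X') (B + B') (Y + Y') := by
  obtain ⟨hX, hY, hY', -⟩ := id h
  obtain ⟨hX', hB, hB', -⟩ := id h'
  refine ⟨by omega, by omega, by omega, fun a b => ?_⟩
  have := ((h.east a b).join_fwd (h'.east (a + X) (b + Y)) (by simp) (by omega)).mono
    (P' := fun x y => a < x ∧ x < a + (X + X') ∧ b - (B + B') ≤ y ∧ y ≤ b + (B + B') ∨
      x = a + (X + X') ∧ y = b + (Y + Y')) (by omega)
  simpa [add_assoc] using this

theorem IsTube.left_right (h : IsTube w X B Y) :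
    IsTube (Turn.L :: (w ++ [Turn.R])) (2 * B + 2) X X := by
  obtain ⟨hX, hY, hY', -⟩ := id h
  refine ⟨by omega, by omega, by omega, fun a b => ?_⟩
  have h₁ := (WalkIn.east (a + 1) b (a + B + 1) (by omega)).join_turn .L
    (h.north (a + B + 1) b) (by simp) (by simp) (by omega)
  have h₂ := h₁.join_turn .R
    (WalkIn.east (a + B + 2 - Y) (b + X) (a + (2 * B + 2)) (by omega)) (by simp)
    (by ext <;> simp; ring) (by omega)
  simpa using h₂.mono (by omega)

theorem IsTube.right_left (h : IsTube w X B Y) :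
    IsTube (Turn.R :: (w ++ [Turn.L])) (2 * B + 2) X (-X) := by
  obtain ⟨hX, hY, hY', -⟩ := id h
  refine ⟨by omega, by omega, by omega, fun a b => ?_⟩
  have h₁ := (WalkIn.east (a + 1) b (a + B + 1) (by omega)).join_turn .R
    (h.south (a + B + 1) b) (by simp) (by ext <;> simp; ring) (by omega)
  have h₂ := h₁.join_turn .L
    (WalkIn.east (a + B + 2 + Y) (b + -X) (a + (2 * B + 2)) (by omega)) (by simp)
    (by ext <;> simp <;> ring) (by omega)
  simpa using h₂.mono (by omega)

end Tube

theorem exists_isTube (w : List Turn) (hw : excess w = 0) : ∃ X B Y, IsTube w X B Y := by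
  induction hn : w.length using Nat.strong_induction_on generalizing w with
  | _ n ih =>
    subst hn
    match w, hw with
    | [], _ => exact ⟨1, 0, 0, isTube_nil⟩
    | .L :: w, hw =>
      simp only [excess_cons_L] at hw
      obtain ⟨u, v, rfl, hu⟩ := exists_split_R w (by omega)
      simp only [excess_append, excess_cons_R] at hw
      obtain ⟨X, B, Y, h⟩ := ih u.length (by simp) u hu rfl
      obtain ⟨X', B', Y', h'⟩ := ih v.length (by simp; omega) v (by omega) rfl
      exact ⟨_, _, _, by simpa using h.left_right.append h'⟩
    | .R :: w, hw =>
      simp only [excess_cons_R] at hw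
      obtain ⟨u, v, rfl, hu⟩ := exists_split_L 0 le_rfl w (by omega)
      simp only [excess_append, excess_cons_L] at hw
      obtain ⟨X, B, Y, h⟩ := ih u.length (by simp) u hu rfl
      obtain ⟨X', B', Y', h'⟩ := ih v.length (by simp; omega) v (by omega) rfl
      exact ⟨_, _, _, by simpa using h.right_left.append h'⟩

/-! ### From walks to chains -/

theorem left_mem_segSet (u v : ℤ × ℤ) : u ∈ segSet u v := by simp [segSet]

theorem right_mem_segSet (u v : ℤ × ℤ) : v ∈ segSet u v := by simp [segSet]

/-- The segment from `p` to `q` is axis-parallel and nondegenerate, with unit direction `e`. -/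
def AxisStep (p q e : ℤ × ℤ) : Prop :=
  ((q.1 = p.1 ∧ q.2 ≠ p.2) ∨ (q.2 = p.2 ∧ q.1 ≠ p.1)) ∧ unitDir p q = e

theorem AxisStep.cases {p q e : ℤ × ℤ} (h : AxisStep p q e) :
    e = (1, 0) ∧ q.2 = p.2 ∧ p.1 < q.1 ∨ e = (-1, 0) ∧ q.2 = p.2 ∧ q.1 < p.1 ∨
      e = (0, 1) ∧ q.1 = p.1 ∧ p.2 < q.2 ∨ e = (0, -1) ∧ q.1 = p.1 ∧ q.2 < p.2 := by
  obtain ⟨h | h, rfl⟩ := h <;> rcases lt_or_gt_of_ne h.2 with h' | h'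
  · simp [unitDir, h.1, h', Int.sign_eq_neg_one_of_neg (sub_neg.2 h')]
  · simp [unitDir, h.1, h', Int.sign_eq_one_of_pos (sub_pos.2 h')]
  · simp [unitDir, h.1, h', Int.sign_eq_neg_one_of_neg (sub_neg.2 h')]
  · simp [unitDir, h.1, h', Int.sign_eq_one_of_pos (sub_pos.2 h')]

theorem AxisStep.of_unit {p : ℤ × ℤ} {e : ℤ × ℤ}
    (he : e = (1, 0) ∨ e = (-1, 0) ∨ e = (0, 1) ∨ e = (0, -1)) : AxisStep p (p + e) e := by
  rcases he with rfl | rfl | rfl | rfl <;> simp [AxisStep, unitDir]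

theorem AxisStep.extend {p q e : ℤ × ℤ} (h : AxisStep p q e) :
    AxisStep p (q + e) e ∧ segSet p (q + e) ⊆ insert (q + e) (segSet p q) := by
  obtain ⟨a, b⟩ := p
  obtain ⟨c, d⟩ := q
  rcases h.cases with ⟨rfl, h₁, h₂⟩ | ⟨rfl, h₁, h₂⟩ | ⟨rfl, h₁, h₂⟩ | ⟨rfl, h₁, h₂⟩ <;>
    simp only at h₁ h₂ <;> subst h₁ <;>
    refine ⟨⟨by simp; omega, ?_⟩, ?_⟩
  any_goals
    rintro ⟨x, y⟩
    simp only [segSet, Set.mem_ofPred_eq, Set.mem_insert_iff, Prod.mk_add_mk, Prod.mk.injEq]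
    omega
  · simp [unitDir]; omega
  · simp [unitDir]; omega
  · simp [unitDir]; omega
  · simp [unitDir]; omega

theorem AxisStep.turn {p q e : ℤ × ℤ} (h : AxisStep p q e) (t : Turn) :
    AxisStep q (q + t.rot e) (t.rot e) ∧ segSet q (q + t.rot e) ⊆ {q, q + t.rot e} := by
  have ht : t.rot e = (1, 0) ∨ t.rot e = (-1, 0) ∨ t.rot e = (0, 1) ∨ t.rot e = (0, -1) := by
    rcases h.cases with ⟨rfl, -⟩ | ⟨rfl, -⟩ | ⟨rfl, -⟩ | ⟨rfl, -⟩ <;> cases t <;> simp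
  refine ⟨.of_unit ht, ?_⟩
  obtain ⟨c, d⟩ := q
  rintro ⟨x, y⟩
  rcases ht with h | h | h | h <;> rw [h] <;>
    simp only [segSet, Set.mem_ofPred_eq, Set.mem_insert_iff, Set.mem_singleton_iff, Prod.mk_add_mk,
      Prod.mk.injEq] <;> omega

/-- The chain `C` ends at `q` with heading `e` and all its segments lie in `S`. -/
def Chain.EndsAt {w : List Turn} (C : Chain w) (S : Set (ℤ × ℤ)) (q e : ℤ × ℤ) : Prop :=
  C.pts (w.length + 1) = q ∧ AxisStep (C.pts w.length) q e ∧
    ∀ i ≤ w.length, segSet (C.pts i) (C.pts (i + 1)) ⊆ S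

theorem Chain.exists_fwd {w : List Turn} {C : Chain w} {S : Set (ℤ × ℤ)} {q e : ℤ × ℤ}
    (hC : C.EndsAt S q e) (hq : q + e ∉ S) :
    ∃ C' : Chain w, C'.EndsAt (insert (q + e) S) (q + e) e := by
  obtain ⟨hend, hstep, hS⟩ := hC
  obtain ⟨hstep', hseg⟩ := hstep.extend
  have hlast : segSet (C.pts w.length) q ⊆ S := hend ▸ hS w.length le_rfl
  set f := Function.update C.pts (w.length + 1) (q + e) with hf
  have f_last : f (w.length + 1) = q + e := by simp [hf]
  have f_old : ∀ i ≤ w.length, f i = C.pts i := fun i hi => by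
    rw [hf, Function.update_of_ne (by omega)]
  have hnew : ∀ i < w.length, ∀ x ∈ segSet (C.pts i) (C.pts (i + 1)),
      x ∈ segSet (C.pts w.length) (q + e) → x ∈ segSet (C.pts w.length) q := fun i hi x hx hx' =>
    (hseg hx').resolve_left fun h => hq (h ▸ hS i hi.le hx)
  refine ⟨⟨f, ?_, ?_, ?_, ?_, ?_, ?_⟩, f_last, ?_, ?_⟩
  · rw [f_old 0 (by omega), C.start_eq]
  · obtain ⟨t, ht, h1⟩ := C.first_seg
    rcases Nat.eq_zero_or_pos w.length with h0 | h0
    · rw [h0] at f_last hstep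
      rw [h0, h1] at hend
      rw [C.start_eq] at hstep
      refine ⟨t + 1, by omega, f_last.trans ?_⟩
      subst hend
      rcases hstep.cases with ⟨rfl, -⟩ | h | h | h
      · simp
      all_goals simp at h <;> omega
    · exact ⟨t, ht, by rw [f_old 1 h0, h1]⟩
  · intro i hi
    rcases hi.lt_or_eq with hi | rfl
    · rw [f_old _ hi, f_old _ hi.le]
      exact C.axis_parallel i hi.le
    · rw [f_last, f_old _ le_rfl]
      exact hstep'.1
  · intro i hi
    rw [f_old i hi.le, f_old (i + 1) hi]
    refine Eq.trans ?_ (C.turns i hi)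
    rcases (Nat.succ_le_of_lt hi).lt_or_eq with h | h
    · rw [f_old (i + 2) h]
    · rw [show i + 2 = w.length + 1 by omega, f_last, hend, show i + 1 = w.length from h,
        hstep'.2, hstep.2]
  · intro i hi
    rw [f_old i (by omega), f_old (i + 1) hi]
    rcases hi.lt_or_eq with h | h
    · rw [f_old (i + 2) h]
      exact C.simple_adj i hi
    · have hadj := C.simple_adj i hi
      rw [show i + 2 = w.length + 1 by omega, hend, h] at hadj
      rw [show i + 2 = w.length + 1 by omega, f_last, h]
      refine Set.Subset.antisymm (fun x hx => ?_) ?_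
      · rw [← hadj]
        exact ⟨hx.1, hnew i (by omega) x (h ▸ hx.1) hx.2⟩
      · rintro x rfl
        exact ⟨right_mem_segSet _ _, left_mem_segSet _ _⟩
  · intro i j hij hj
    rw [f_old i (by omega), f_old (i + 1) (by omega), f_old j hj]
    have hadj := C.simple_nonadj i j hij hj
    rcases hj.lt_or_eq with h | rfl
    · rwa [f_old (j + 1) h]
    · rw [hend] at hadj
      rw [f_last, ← Set.subset_empty_iff, ← hadj]
      exact fun x hx => ⟨hx.1, hnew i (by omega) x hx.1 hx.2⟩
  · change AxisStep (f w.length) _ _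
    rwa [f_old _ le_rfl]
  · intro i hi
    change segSet (f i) (f (i + 1)) ⊆ _
    rw [f_old i hi]
    rcases hi.lt_or_eq with h | rfl
    · rw [f_old (i + 1) h]
      exact (hS i hi).trans (Set.subset_insert _ _)
    · rw [f_last]
      exact hseg.trans (Set.insert_subset_insert hlast)

theorem Chain.exists_turn {w : List Turn} {C : Chain w} {S : Set (ℤ × ℤ)} {q e : ℤ × ℤ} (t : Turn)
    (hC : C.EndsAt S q e) (hq : q + t.rot e ∉ S) :
    ∃ C' : Chain (w ++ [t]), C'.EndsAt (insert (q + t.rot e) S) (q + t.rot e) (t.rot e) := by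
  obtain ⟨hend, hstep, hS⟩ := hC
  obtain ⟨hstep', hseg⟩ := hstep.turn t
  have hlast : segSet (C.pts w.length) q ⊆ S := hend ▸ hS w.length le_rfl
  have hlen : (w ++ [t]).length = w.length + 1 := by simp
  set f := Function.update C.pts (w.length + 2) (q + t.rot e) with hf
  have f_last : f (w.length + 2) = q + t.rot e := by simp [hf]
  have f_old : ∀ i ≤ w.length + 1, f i = C.pts i := fun i hi => by
    rw [hf, Function.update_of_ne (by omega)]
  have hnew : ∀ i ≤ w.length, ∀ x ∈ segSet (C.pts i) (C.pts (i + 1)),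
      x ∈ segSet q (q + t.rot e) → x = q := fun i hi x hx hx' =>
    (hseg hx').resolve_right fun h => hq (h ▸ hS i hi hx)
  refine ⟨⟨f, ?_, ?_, ?_, ?_, ?_, ?_⟩, ?_, ?_, ?_⟩
  · rw [f_old 0 (by omega), C.start_eq]
  · rw [f_old 1 (by omega)]
    exact C.first_seg
  · intro i hi
    rw [hlen] at hi
    rw [f_old i hi]
    rcases hi.lt_or_eq with hi | rfl
    · rw [f_old (i + 1) hi]
      exact C.axis_parallel i (by omega)
    · rw [f_last, hend]
      exact hstep'.1
  · intro i hi
    rw [hlen] at hi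
    rw [f_old i hi.le, f_old (i + 1) hi]
    rcases (Nat.le_of_lt_succ hi).lt_or_eq with h | rfl
    · rw [f_old (i + 2) (by omega)]
      simpa [List.getElem_append_left h] using C.turns i h
    · rw [f_last, hend, hstep'.2, hstep.2]
      simp [Turn.rot]
  · intro i hi
    rw [hlen] at hi
    rw [f_old i (by omega), f_old (i + 1) hi]
    rcases hi.lt_or_eq with h | h
    · rw [f_old (i + 2) h]
      exact C.simple_adj i (by omega)
    · obtain rfl : i = w.length := by omega
      rw [f_last, hend]
      refine Set.Subset.antisymm (fun x hx => ?_) ?_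
      · exact hnew _ le_rfl x (hend ▸ hx.1) hx.2
      · rintro x rfl
        exact ⟨right_mem_segSet _ _, left_mem_segSet _ _⟩
  · intro i j hij hj
    rw [hlen] at hj
    rw [f_old i (by omega), f_old (i + 1) (by omega), f_old j hj]
    rcases hj.lt_or_eq with h | rfl
    · rw [f_old (j + 1) h]
      exact C.simple_nonadj i j hij (by omega)
    · rw [f_last, hend, Set.eq_empty_iff_forall_notMem]
      rintro x ⟨hx, hx'⟩
      obtain rfl := hnew i (by omega) x hx hx'
      rcases (show i + 1 ≤ w.length by omega).lt_or_eq with h | h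
      · have hadj := C.simple_nonadj i w.length h le_rfl
        rw [hend] at hadj
        exact hadj.subset ⟨hx, right_mem_segSet _ _⟩
      · have hadj := C.simple_adj i (by omega)
        rw [show i + 2 = w.length + 1 by omega, hend] at hadj
        have hp : x = C.pts (i + 1) := hadj.subset ⟨hx, right_mem_segSet _ _⟩
        rw [h] at hp
        rcases hstep.1 with h' | h' <;> simp [hp] at h'
  · change f ((w ++ [t]).length + 1) = _
    rw [hlen, f_last]
  · change AxisStep (f (w ++ [t]).length) _ _
    rwa [hlen, f_old _ le_rfl, hend]
  · intro i hi
    rw [hlen] at hi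
    change segSet (f i) (f (i + 1)) ⊆ _
    rw [f_old i hi]
    rcases hi.lt_or_eq with h | rfl
    · rw [f_old (i + 1) h]
      exact (hS i (by omega)).trans (Set.subset_insert _ _)
    · rw [f_last, hend]
      refine hseg.trans (Set.insert_subset (Set.mem_insert_of_mem _ ?_) (by simp))
      exact hlast (right_mem_segSet _ _)

theorem Walk.exists_chain {w : List Turn} {S : Set (ℤ × ℤ)} {q e : ℤ × ℤ}
    (h : Walk (1, 0) (1, 0) w S q e) (h0 : (0, 0) ∉ S) :
    ∃ C : Chain w, C.EndsAt (insert (0, 0) S) q e := by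
  induction h with
  | single =>
    refine ⟨⟨fun i => (i, 0), by simp, ⟨1, by simp⟩, ?_, ?_, ?_, ?_⟩, ?_, ?_, ?_⟩
    · simp
    · simp
    · simp
    · intro i j hij hj
      simp at hj
      omega
    · simp
    · simp [AxisStep, unitDir]
    · rintro i hi ⟨x, y⟩
      obtain rfl : i = 0 := by simpa using hi
      simp [segSet]
      omega
  | fwd _ hq ih =>
    simp only [Set.mem_insert_iff, not_or] at h0
    obtain ⟨C, hC⟩ := ih h0.2
    rw [Set.insert_comm]
    exact C.exists_fwd hC (by simp [hq, Ne.symm h0.1])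
  | turn t _ hq ih =>
    simp only [Set.mem_insert_iff, not_or] at h0
    obtain ⟨C, hC⟩ := ih h0.2
    rw [Set.insert_comm]
    exact C.exists_turn t hC (by simp only [Set.mem_insert_iff, hq, or_false]; exact Ne.symm h0.1)

theorem WalkIn.exists_chain {v w : List Turn} {P : ℤ → ℤ → Prop} {p q e : ℤ × ℤ}
    (h : WalkIn (1, 0) (1, 0) v P p e) (h0 : ¬ P 0 0) (hw : v = w) (hq : p = q) :
    ∃ C : Chain w, C.pts (w.length + 1) = q := by
  subst hw hq
  obtain ⟨S, hS, hSP⟩ := h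
  obtain ⟨C, hC⟩ := hS.exists_chain fun h => h0 (hSP 0 0 h)
  exact ⟨C, hC.1⟩

/-! ### Loops around the origin -/

/-- The region south-east of a walk that ends at `(h, k)` heading south, which a further loop
of the walk passes through: a strip of half-width `D` along the row `k`, a strip of width `D` to the
right of the column `m`, and a strip of half-width `D` along the `x`-axis to the right of `a`. -/
def LoopRegion (D a h k m x y : ℤ) : Prop :=
  h < x ∧ x ≤ m + D ∧ k - D ≤ y ∧ y ≤ k + D ∨ m < x ∧ x ≤ m + D ∧ k ≤ y ∧ y ≤ D ∨
    a < x ∧ x ≤ m + D ∧ -D ≤ y ∧ y ≤ D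

/-- Walks with turns `w` reach a point from which they can make another loop around the origin
that crosses the `x`-axis directly to the right of `a`. -/
def SouthReady (a : ℤ) (w : List Turn) : Prop :=
  ∀ D, 0 ≤ D → ∃ h k m P, WalkIn (1, 0) (1, 0) w P (h, k) (0, -1) ∧ ¬ P 0 0 ∧ h ≤ m ∧ a ≤ m ∧
    k ≤ -3 * D ∧ ∀ x y, P x y → ¬ LoopRegion D a h k m x y

/-- Walks with turns `w` reach, heading west, the corner of an empty box around the point `(b, 0)`
of any prescribed size. -/
def WestReady (b : ℤ) (w : List Turn) : Prop :=
  ∀ D, 0 ≤ D → ∃ P, WalkIn (1, 0) (1, 0) w P (b + D, D) (-1, 0) ∧ ¬ P 0 0 ∧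
    ∀ x y, P x y → ¬ (b ≤ x ∧ x < b + D ∧ -D ≤ y ∧ y ≤ D)

theorem WestReady.exists_chain {b : ℤ} {w : List Turn} (hw : WestReady b w) :
    ∃ C : Chain w, C.pts (w.length + 1) = (b, 0) := by
  obtain ⟨P, hP, h0, -⟩ := hw 0 le_rfl
  exact hP.exists_chain h0 rfl (by simp)

/-- The three-quarter turn in a loop around the origin. -/
theorem exists_loop {u : List Turn} (hu : excess u = 2) (D' : ℤ) (hD' : 0 ≤ D') :
    ∃ D, D' < D ∧ ∀ a h k m, h ≤ m → a ≤ m → k ≤ -3 * D →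
      WalkIn (h + 1, k) (1, 0) u
        (fun x y => LoopRegion D a h k m x y ∧
          (y < -D' ∨ a + 1 + D' < x ∨ x = a + 1 + D' ∧ y = D'))
        (a + 1 + D', D') (-1, 0) := by
  obtain ⟨M₀, v, rfl, h₀⟩ := exists_split_L 0 le_rfl u (by omega)
  simp only [excess_append, excess_cons_L] at hu
  obtain ⟨M₁, M₂, rfl, h₁⟩ := exists_split_L 0 le_rfl v (by omega)
  simp only [excess_append, excess_cons_L] at hu
  obtain ⟨X₀, B₀, Y₀, h₀⟩ := exists_isTube M₀ h₀
  obtain ⟨X₁, B₁, Y₁, h₁⟩ := exists_isTube M₁ h₁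
  obtain ⟨X₂, B₂, Y₂, h₂⟩ := exists_isTube M₂ (by omega)
  obtain ⟨hX₀, hY₀, hY₀', -⟩ := id h₀
  obtain ⟨hX₁, hY₁, hY₁', -⟩ := id h₁
  obtain ⟨hX₂, hY₂, hY₂', -⟩ := id h₂
  refine ⟨X₀ + X₁ + X₂ + 3 * (B₀ + B₁ + B₂) + 3 * D' + 10, by omega,
    fun a h k m hhm ham hk => ?_⟩
  obtain ⟨c, hc⟩ : ∃ c, c = m + D' + X₀ + 2 * B₁ + X₂ + 3 := ⟨_, rfl⟩
  have w₁ := (h₀.east h k).join_fwd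
    (WalkIn.east (h + X₀ + 1) (k + Y₀) c (by omega)) (by simp) (by omega)
  have w₂ := w₁.join_turn .L (h₁.north c (k + Y₀)) (by simp) (by simp) (by omega)
  have w₃ := w₂.join_fwd
    (WalkIn.north (c - Y₁) (k + Y₀ + X₁ + 1) (D' + Y₂) (by omega)) (by simp) (by omega)
  have w₄ := w₃.join_turn .L (h₂.west (c - Y₁) (D' + Y₂)) (by simp)
    (by ext <;> simp; ring) (by omega)
  have w₅ := w₄.join_fwd
    (WalkIn.west (c - Y₁ - X₂ - 1) (D' + Y₂ - Y₂) (a + 1 + D') (by omega))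
    (by ext <;> simp; ring) (by omega)
  simpa using w₅.mono (by unfold LoopRegion; omega)

theorem SouthReady.loop {a : ℤ} {w u : List Turn} (ha : 0 ≤ a) (hw : SouthReady a w)
    (hu : excess u = 2) : WestReady (a + 1) (w ++ Turn.L :: u) := by
  intro D' hD'
  obtain ⟨D, hD, hloop⟩ := exists_loop hu D' hD'
  obtain ⟨h, k, m, P, hP, h0, hhm, ham, hk, hfree⟩ := hw D (by omega)
  refine ⟨_, hP.join_turn .L (hloop a h k m hhm ham hk) (by simp) (by simp)
    fun x y hx hx' => hfree x y hx hx'.1, by simp only [h0, false_or]; omega, ?_⟩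
  rintro x y (hx | hx)
  · have := hfree x y hx
    unfold LoopRegion at this
    omega
  · omega

theorem WestReady.left {b : ℤ} {w : List Turn} (hb : 1 ≤ b) (hw : WestReady b w) :
    SouthReady b (w ++ [Turn.L]) := by
  intro D hD
  obtain ⟨P, hP, h0, hfree⟩ := hw (5 * D + 5) (by omega)
  have w₁ := hP.join_fwd (WalkIn.west (b + (5 * D + 5) - 1) (5 * D + 5) b (by omega))
    (by ext <;> simp; ring) (fun x y hx => by have := hfree x y hx; omega)
  have w₂ := w₁.join_turn .L (WalkIn.south b (5 * D + 5 - 1) (-4 * D - 4) (by omega)) (by simp)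
    (by ext <;> simp; ring) (fun x y hx => by
      rcases hx with hx | hx
      · have := hfree x y hx; omega
      · omega)
  refine ⟨b, -4 * D - 4, b, _, by simpa using w₂, by simp only [h0, false_or]; omega, le_rfl,
    le_rfl, by omega, fun x y hx => ?_⟩
  unfold LoopRegion
  rcases hx with (hx | hx) | hx
  · have := hfree x y hx; omega
  · omega
  · omega

/-- Walks starting with a right turn, ending south of the origin. -/
theorem exists_walk_south {M : List Turn} (hM : excess M = 0) (D : ℤ) (hD : 0 ≤ D) :
    ∃ h k m P, WalkIn (1, 0) (1, 0) (Turn.R :: M) P (h, k) (0, -1) ∧ h ≤ m ∧ 1 ≤ m ∧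
      k ≤ -3 * D ∧ ∀ x y, P x y → ¬ LoopRegion D 1 h k m x y ∧ y ≤ 0 ∧ (x = 1 ∨ y ≠ 0) := by
  obtain ⟨X, B, Y, hM⟩ := exists_isTube M hM
  obtain ⟨hX, hY, hY', -⟩ := id hM
  have w₁ := (WalkIn.single 1 0 (1, 0)).join_turn .R
    (WalkIn.south 1 (-1) (-D - 1) (by omega)) (by simp) (by simp) (by omega)
  have w₂ := w₁.join_fwd (hM.south 1 (-D - 1)) (by ext <;> simp; ring) (by omega)
  have w₃ := w₂.join_fwd
    (WalkIn.south (1 + Y) (-D - 1 - X - 1) (-D - 1 - X - 4 * D - 1) (by omega))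
    (by ext <;> simp; ring) (by omega)
  refine ⟨1 + Y, -D - 1 - X - 4 * D - 1, 1 + B, _, by simpa using w₃, by omega, by omega, by omega,
    fun x y hx => ?_⟩
  unfold LoopRegion
  omega

theorem southReady_R {M : List Turn} (hM : excess M = 0) : SouthReady 1 (Turn.R :: M) := by
  intro D hD
  obtain ⟨h, k, m, P, hP, hhm, hm, hk, hfree⟩ := exists_walk_south hM D hD
  exact ⟨h, k, m, P, hP, fun h => by simpa using (hfree 0 0 h).2.2, hhm, hm, hk,
    fun x y hx => (hfree x y hx).1⟩

/-- Walks starting with a left turn, passing north of the origin and descending to its west. -/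
theorem exists_walk_north_west {M₁ M₂ : List Turn} (h₁ : excess M₁ = 0) (h₂ : excess M₂ = 0) :
    ∃ c m : ℤ, 0 < c ∧ 1 ≤ m ∧ ∀ D h k, 0 ≤ D → h ≤ -c → k ≤ D → ∃ P,
      WalkIn (1, 0) (1, 0) (Turn.L :: M₁ ++ Turn.L :: M₂ ++ [Turn.L]) P (h, k) (0, -1) ∧
      ∀ x y, P x y → x = h ∧ k ≤ y ∨ h < x ∧ x ≤ m ∧ D < y ∨ x = 1 ∧ 0 ≤ y ∧ y ≤ D := by
  obtain ⟨X₁, B₁, Y₁, h₁⟩ := exists_isTube M₁ h₁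
  obtain ⟨X₂, B₂, Y₂, h₂⟩ := exists_isTube M₂ h₂
  obtain ⟨hX₁, hY₁, hY₁', -⟩ := id h₁
  obtain ⟨hX₂, hY₂, hY₂', -⟩ := id h₂
  refine ⟨B₁ + X₂ + 1, 1 + B₁, by omega, by omega, fun D h k hD hh hk => ?_⟩
  obtain ⟨r, hr⟩ : ∃ r, r = D + 1 + X₁ + B₂ + 1 := ⟨_, rfl⟩
  have w₁ := (WalkIn.single 1 0 (1, 0)).join_turn .L
    (WalkIn.north 1 1 (D + 1) (by omega)) (by simp) (by simp) (by omega)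
  have w₂ := w₁.join_fwd (h₁.north 1 (D + 1)) (by simp) (by omega)
  have w₃ := w₂.join_fwd (WalkIn.north (1 - Y₁) (D + 1 + X₁ + 1) r (by omega))
    (by simp) (by omega)
  have w₄ := w₃.join_turn .L (h₂.west (1 - Y₁) r) (by simp) (by ext <;> simp; ring) (by omega)
  have w₅ := w₄.join_fwd (WalkIn.west (1 - Y₁ - X₂ - 1) (r - Y₂) h (by omega))
    (by ext <;> simp; ring) (by omega)
  have w₆ := w₅.join_turn .L (WalkIn.south h (r - Y₂ - 1) k (by omega)) (by simp)
    (by ext <;> simp; ring) (by omega)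
  exact ⟨_, by simpa using w₆, by omega⟩

theorem southReady_L {M₁ M₂ : List Turn} (h₁ : excess M₁ = 0) (h₂ : excess M₂ = 0) :
    SouthReady 1 (Turn.L :: M₁ ++ Turn.L :: M₂ ++ [Turn.L]) := by
  intro D hD
  obtain ⟨c, m, hc, hm, hwalk⟩ := exists_walk_north_west h₁ h₂
  obtain ⟨P, hP, hreg⟩ := hwalk D (-c) (-3 * D - 1) hD le_rfl (by omega)
  refine ⟨_, _, m, P, hP, fun h => by have := hreg 0 0 h; omega, by omega, hm, by omega,
    fun x y hx => ?_⟩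
  have := hreg x y hx
  unfold LoopRegion
  omega

/-! ### Words of excess `2` modulo `4` -/

theorem westReady_two {w : List Turn} (hw : excess w = 2) (hR : w.head? = some Turn.R) :
    WestReady 2 w := by
  obtain ⟨v, rfl⟩ := List.head?_eq_some_iff.1 hR
  simp only [excess_cons_R] at hw
  obtain ⟨M, u, rfl, hM⟩ := exists_split_L 0 le_rfl v (by omega)
  simp only [excess_append, excess_cons_L] at hw
  simpa using (southReady_R hM).loop zero_le_one (u := u) (by omega)

theorem westReady_six {w : List Turn} (hw : excess w = 6) (hL : w.head? = some Turn.L) :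
    WestReady 2 w := by
  obtain ⟨v, rfl⟩ := List.head?_eq_some_iff.1 hL
  simp only [excess_cons_L] at hw
  obtain ⟨v', u, rfl, hv⟩ := exists_left_hook 1 zero_le_one v (by omega)
  simp only [excess_append, excess_cons_L, hv] at hw
  obtain ⟨M₁, M₂, rfl, h₁⟩ := exists_split_L 0 le_rfl v' (by omega)
  simp only [excess_append, excess_cons_L] at hv
  simpa using (southReady_L h₁ (M₂ := M₂) (by omega)).loop zero_le_one (u := u) (by omega)

/-- Every additional full turn of the word costs at most one unit on the `x`-axis. -/
theorem WestReady.of_excess {t : Turn} {e b : ℤ} (he : 2 ≤ e) (hb : 1 ≤ b)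
    (hbase : ∀ w, excess w = e → w.head? = some t → WestReady b w) (n : ℕ) (w : List Turn)
    (hw : excess w = e + 4 * n) (ht : w.head? = some t) : WestReady (b + n) w := by
  induction n generalizing w with
  | zero => simpa using hbase w (by simpa using hw) ht
  | succ n ih =>
    push_cast at hw ⊢
    obtain ⟨v, u, rfl, hv⟩ := exists_left_hook (e + 4 * n) (by omega) w (by omega)
    simp only [excess_append, excess_cons_L] at hw
    have hne : v ≠ [] := by
      rintro rfl
      simp at hv
      omega
    rw [List.head?_append_of_ne_nil _ hne] at ht
    simpa [add_assoc] using
      ((ih v hv ht).left (by omega)).loop (by omega) (u := u) (by omega)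

/-! ### Words of excess `3` and `5` -/

theorem exists_chain_of_excess_three {w : List Turn} (hw : excess w = 3)
    (hR : w.head? = some Turn.R) : ∃ C : Chain w, C.pts (w.length + 1) = (2, 0) := by
  obtain ⟨v, rfl⟩ := List.head?_eq_some_iff.1 hR
  simp only [excess_cons_R] at hw
  obtain ⟨v', M₃, rfl, hv⟩ := exists_split_L 3 (by norm_num) v (by omega)
  simp only [excess_append, excess_cons_L, hv] at hw
  obtain ⟨M, u, rfl, hM⟩ := exists_split_L 0 le_rfl v' (by omega)
  simp only [excess_append, excess_cons_L] at hv
  obtain ⟨X, B, Y, h₃⟩ := exists_isTube M₃ (by omega)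
  obtain ⟨hX, hY, hY', -⟩ := id h₃
  obtain ⟨D, hD, hloop⟩ := exists_loop (show excess u = 2 by omega) (X + 2 * B + 1) (by omega)
  obtain ⟨h, k, m, P, hP, hhm, hm, hk, hfree⟩ := exists_walk_south hM D (by omega)
  have w₁ := hP.join_turn .L (hloop 1 h k m hhm hm hk) (by simp) (by simp)
    fun x y hx hx' => (hfree x y hx).1 hx'.1
  have w₂ := (w₁.mono (P' := fun x y => y ≤ 0 ∧ (x = 1 ∨ y ≠ 0) ∨
      y < -(X + 2 * B + 1) ∨ 2 + (X + 2 * B + 1) < x ∨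
      x = 2 + (X + 2 * B + 1) ∧ y = X + 2 * B + 1) (by
    rintro x y (hx | hx)
    · exact Or.inl (hfree x y hx).2
    · omega)).join_fwd (WalkIn.west (2 + (X + 2 * B + 1) - 1) (X + 2 * B + 1) (2 - Y) (by omega))
    (by ext <;> simp; ring) (by omega)
  have w₃ := w₂.join_turn .L (h₃.south (2 - Y) (X + 2 * B + 1)) (by simp) (by simp)
    (by omega)
  have w₄ := w₃.join_fwd (WalkIn.south (2 - Y + Y) (X + 2 * B + 1 - X - 1) 0 (by omega))
    (by ext <;> simp; ring) (by omega)
  exact w₄.exists_chain (by omega) (by simp) (by simp)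

theorem exists_chain_of_excess_five {w : List Turn} (hw : excess w = 5)
    (hL : w.head? = some Turn.L) : ∃ C : Chain w, C.pts (w.length + 1) = (2, 0) := by
  obtain ⟨v, rfl⟩ := List.head?_eq_some_iff.1 hL
  simp only [excess_cons_L] at hw
  obtain ⟨v₁, v₂, rfl, hv⟩ := exists_left_hook 1 zero_le_one v (by omega)
  simp only [excess_append, excess_cons_L, hv] at hw
  obtain ⟨M₁, M₂, rfl, h₁⟩ := exists_split_L 0 le_rfl v₁ (by omega)
  simp only [excess_append, excess_cons_L] at hv
  obtain ⟨M₄, M₅, rfl, h₄⟩ := exists_split_L 0 le_rfl v₂ (by omega)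
  simp only [excess_append, excess_cons_L] at hw
  obtain ⟨X₄, B₄, Y₄, h₄⟩ := exists_isTube M₄ h₄
  obtain ⟨X₅, B₅, Y₅, h₅⟩ := exists_isTube M₅ (by omega)
  obtain ⟨hX₄, hY₄, hY₄', -⟩ := id h₄
  obtain ⟨hX₅, hY₅, hY₅', -⟩ := id h₅
  obtain ⟨c, m, hc, hm, hwalk⟩ := exists_walk_north_west h₁ (M₂ := M₂) (by omega)
  obtain ⟨h, hh⟩ : ∃ h, h = -c - X₄ - 2 * B₅ := ⟨_, rfl⟩
  obtain ⟨k, hk⟩ : ∃ k, k = -B₄ - X₅ - 1 := ⟨_, rfl⟩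
  obtain ⟨P, hP, hreg⟩ := hwalk 0 h k le_rfl (by omega) (by omega)
  have w₁ := (hP.mono hreg).join_turn .L (h₄.east h k) (by simp) (by simp) (by omega)
  have w₂ := w₁.join_fwd (WalkIn.east (h + X₄ + 1) (k + Y₄) (2 + Y₅) (by omega)) (by simp)
    (by omega)
  have w₃ := w₂.join_turn .L (h₅.north (2 + Y₅) (k + Y₄)) (by simp) (by simp) (by omega)
  have w₄ := w₃.join_fwd (WalkIn.north (2 + Y₅ - Y₅) (k + Y₄ + X₅ + 1) 0 (by omega)) (by simp)
    (by omega)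
  exact w₄.exists_chain (by omega) (by simp) (by simp)

/-- **Upper bounds on the closest reachable point on the `+x`-axis (clean cases).** -/
theorem upper_bound_x_plus_clean (σ : List Turn) :
    (excess σ = 2 → σ.head? = some Turn.R →
      ∃ (C : Chain σ) (a : ℤ), 1 ≤ a ∧ a ≤ 2 ∧ C.pts (σ.length + 1) = (a, 0)) ∧
    (excess σ = 3 → σ.head? = some Turn.R →
      ∃ (C : Chain σ) (a : ℤ), 1 ≤ a ∧ a ≤ 2 ∧ C.pts (σ.length + 1) = (a, 0)) ∧
    (excess σ = 5 → σ.head? = some Turn.L →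
      ∃ (C : Chain σ) (a : ℤ), 1 ≤ a ∧ a ≤ 2 ∧ C.pts (σ.length + 1) = (a, 0)) ∧
    (6 ≤ excess σ → excess σ % 4 = 2 → σ.head? = some Turn.L →
      ∃ (C : Chain σ) (a : ℤ), 1 ≤ a ∧ a ≤ (excess σ + 2) / 4 ∧
        C.pts (σ.length + 1) = (a, 0)) ∧
    (6 ≤ excess σ → excess σ % 4 = 2 → σ.head? = some Turn.R →
      ∃ (C : Chain σ) (a : ℤ), 1 ≤ a ∧ a ≤ (excess σ + 2) / 4 + 1 ∧
        C.pts (σ.length + 1) = (a, 0)) := by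
  refine ⟨fun h hR => ?_, fun h hR => ?_, fun h hL => ?_, fun h hmod hL => ?_, fun h hmod hR => ?_⟩
  · obtain ⟨C, hC⟩ := (westReady_two h hR).exists_chain
    exact ⟨C, 2, by norm_num, le_rfl, hC⟩
  · obtain ⟨C, hC⟩ := exists_chain_of_excess_three h hR
    exact ⟨C, 2, by norm_num, le_rfl, hC⟩
  · obtain ⟨C, hC⟩ := exists_chain_of_excess_five h hL
    exact ⟨C, 2, by norm_num, le_rfl, hC⟩
  · obtain ⟨n, hn⟩ : ∃ n : ℕ, excess σ = 6 + 4 * n := ⟨((excess σ - 6) / 4).toNat, by omega⟩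
    obtain ⟨C, hC⟩ := (WestReady.of_excess (by norm_num) (by norm_num)
      (fun _ => westReady_six) n σ hn hL).exists_chain
    exact ⟨C, _, by omega, by omega, hC⟩
  · obtain ⟨n, hn⟩ : ∃ n : ℕ, excess σ = 2 + 4 * n := ⟨((excess σ - 2) / 4).toNat, by omega⟩
    obtain ⟨C, hC⟩ := (WestReady.of_excess (by norm_num) (by norm_num)
      (fun _ => westReady_two) n σ hn hR).exists_chain
    exact ⟨C, _, by omega, by omega, hC⟩
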